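/- Let f : S^{n-1} → S^{n-1} be a continuous map on the unit sphere of an n-dimensional real inner product space (n ≥ 2) such that f ∘ f = id and f has no fixed point (f(u) ≠ u for all u). Then there exists a point u ∈ S^{n-1} with f(u) = -u. -/

import Mathlib

namespace ListChain

/-- Mod 2 chains on ordered tuples; a list of length `k` is a `(k - 1)`-simplex, and the empty list
is the augmentation simplex. -/
abbrev Chain (V : Type*) := List V →₀ ZMod 2

variable {V W X : Type*}

/-- The cone operator with apex `v`. -/
noncomputable def cone (v : V) : Chain V →ₗ[ZMod 2] Chain V :=
  Finsupp.lmapDomain _ _ (List.cons v)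

@[simp] lemma cone_single (v : V) (l : List V) :
    cone v (Finsupp.single l 1) = Finsupp.single (v :: l) 1 := by
  simp [cone, Finsupp.mapDomain_single]

/-- The map induced on chains by a map of vertices. -/
noncomputable def map (g : V → W) : Chain V →ₗ[ZMod 2] Chain W :=
  Finsupp.lmapDomain _ _ (List.map g)

@[simp] lemma map_single (g : V → W) (l : List V) :
    map g (Finsupp.single l 1) = Finsupp.single (l.map g) 1 := by
  simp [map, Finsupp.mapDomain_single]

/-- The linear extension of a function on simplices. -/
noncomputable def extend {M : Type*} [AddCommGroup M] [Module (ZMod 2) M] (F : List V → M) :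
    Chain V →ₗ[ZMod 2] M :=
  Finsupp.linearCombination (ZMod 2) F

@[simp] lemma extend_single {M : Type*} [AddCommGroup M] [Module (ZMod 2) M] (F : List V → M)
    (l : List V) : extend F (Finsupp.single l 1) = F l := by
  simp [extend]

/-- Chains all of whose simplices lie in `A`. -/
noncomputable abbrev Supp (A : Set (List V)) : Submodule (ZMod 2) (Chain V) :=
  Finsupp.supported (ZMod 2) (ZMod 2) A

lemma single_mem {A : Set (List V)} {l : List V} (h : l ∈ A) :
    (Finsupp.single l 1 : Chain V) ∈ Supp A :=
  Finsupp.single_mem_supported _ _ h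

lemma eq_of_mem {M : Type*} [AddCommGroup M] [Module (ZMod 2) M] {A : Set (List V)}
    {L₁ L₂ : Chain V →ₗ[ZMod 2] M}
    (h : ∀ l ∈ A, L₁ (Finsupp.single l 1) = L₂ (Finsupp.single l 1)) {c : Chain V}
    (hc : c ∈ Supp A) : L₁ c = L₂ c := by
  rw [Supp, Finsupp.supported_eq_span_single] at hc
  refine LinearMap.eqOn_span ?_ hc
  rintro _ ⟨l, hl, rfl⟩
  exact h l hl

lemma apply_eq_of_single {M : Type*} [AddCommGroup M] [Module (ZMod 2) M]
    {L₁ L₂ : Chain V →ₗ[ZMod 2] M}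
    (h : ∀ l, L₁ (Finsupp.single l 1) = L₂ (Finsupp.single l 1)) (c : Chain V) :
    L₁ c = L₂ c :=
  eq_of_mem (A := Set.univ) (fun l _ => h l) (by simp [Supp])

lemma apply_mem {A : Set (List V)} {B : Set (List W)} {L : Chain V →ₗ[ZMod 2] Chain W}
    (h : ∀ l ∈ A, L (Finsupp.single l 1) ∈ Supp B) {c : Chain V} (hc : c ∈ Supp A) :
    L c ∈ Supp B := by
  rw [Supp, Finsupp.supported_eq_span_single] at hc
  have : Submodule.span (ZMod 2) ((fun i => Finsupp.single i (1 : ZMod 2)) '' A) ≤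
      (Supp B).comap L := by
    rw [Submodule.span_le]
    rintro _ ⟨l, hl, rfl⟩
    exact h l hl
  exact this hc

lemma supp_mono {A B : Set (List V)} (h : A ⊆ B) {c : Chain V} (hc : c ∈ Supp A) : c ∈ Supp B :=
  Finsupp.supported_mono h hc

lemma add_self (c : Chain V) : c + c = 0 := by
  rw [← two_smul (ZMod 2) c, show (2 : ZMod 2) = 0 from rfl, zero_smul]

lemma map_map (g : V → W) (h : W → X) (c : Chain V) : map h (map g c) = map (h ∘ g) c := by
  rw [← LinearMap.comp_apply]
  exact apply_eq_of_single (by simp) c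

lemma map_id (c : Chain V) : map id c = c := by
  conv_rhs => rw [← LinearMap.id_apply (R := ZMod 2) c]
  exact apply_eq_of_single (by simp) c

lemma cone_map (g : V → W) (v : V) (c : Chain V) : map g (cone v c) = cone (g v) (map g c) := by
  rw [← LinearMap.comp_apply, ← LinearMap.comp_apply]
  exact apply_eq_of_single (by simp) c

/-- The boundary of a simplex. -/
noncomputable def faces : List V → Chain V
  | [] => 0
  | v :: l => Finsupp.single l 1 + cone v (faces l)

/-- The boundary operator. -/
noncomputable def boundary : Chain V →ₗ[ZMod 2] Chain V := extend faces

@[simp] lemma boundary_single (l : List V) : boundary (Finsupp.single l 1) = faces l := by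
  simp [boundary]

lemma boundary_cone (v : V) (c : Chain V) :
    boundary (cone v c) = c + cone v (boundary c) := by
  have := apply_eq_of_single (L₁ := boundary ∘ₗ cone v)
    (L₂ := LinearMap.id + cone v ∘ₗ boundary) (by simp [faces]) c
  simpa using this

lemma boundary_faces (l : List V) : boundary (faces l) = 0 := by
  induction l with
  | nil => simp [faces]
  | cons v l ih => simp [faces, boundary_cone, ih, add_self]

lemma boundary_boundary (c : Chain V) : boundary (boundary c) = 0 :=
  apply_eq_of_single (L₁ := boundary ∘ₗ boundary) (L₂ := 0) (by simp [boundary_faces]) c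

lemma map_faces (g : V → W) (l : List V) : map g (faces l) = faces (l.map g) := by
  induction l with
  | nil => simp [faces]
  | cons v l ih => simp [faces, cone_map, ih]

lemma boundary_map (g : V → W) (c : Chain V) : boundary (map g c) = map g (boundary c) := by
  rw [← LinearMap.comp_apply, ← LinearMap.comp_apply]
  exact apply_eq_of_single (by simp [map_faces]) c

lemma faces_mem (l : List V) : faces l ∈ Supp {l' | l'.length + 1 = l.length ∧ l' ⊆ l} := by
  induction l with
  | nil => simp [faces]
  | cons v l ih =>
    refine Submodule.add_mem _ (single_mem (by simp)) (apply_mem (fun l' hl' => ?_) ih)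
    rw [cone_single]
    exact single_mem (And.imp (by simp) (List.cons_subset_cons v) hl')

/-- The prism between the images of a simplex under two maps of vertices. -/
noncomputable def prism (p q : V → W) : List V → Chain W
  | [] => 0
  | v :: l => Finsupp.single (p v :: q v :: l.map q) 1 + cone (p v) (prism p q l)

lemma extend_prism_cone (p q : V → W) (v : V) (c : Chain V) :
    extend (prism p q) (cone v c) =
      cone (p v) (cone (q v) (map q c)) + cone (p v) (extend (prism p q) c) := by
  have := apply_eq_of_single (L₁ := extend (prism p q) ∘ₗ cone v)
    (L₂ := cone (p v) ∘ₗ cone (q v) ∘ₗ map q + cone (p v) ∘ₗ extend (prism p q))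
    (by simp [prism]) c
  simpa using this

lemma boundary_prism (p q : V → W) (l : List V) :
    boundary (prism p q l) =
      Finsupp.single (l.map p) 1 + Finsupp.single (l.map q) 1 + extend (prism p q) (faces l) := by
  induction l with
  | nil => simp [prism, faces, add_self]
  | cons v l ih =>
    simp only [prism, faces, map_add, boundary_single, boundary_cone, ih, extend_single,
      extend_prism_cone, List.map_cons, cone_single, map_faces]
    have h := add_self (Finsupp.single (p v :: l.map q) 1 : Chain W)
    linear_combination (norm := abel) h

lemma boundary_extend_prism (p q : V → W) (c : Chain V) :
    boundary (extend (prism p q) c) =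
      map p c + map q c + extend (prism p q) (boundary c) := by
  have := apply_eq_of_single (L₁ := boundary ∘ₗ extend (prism p q))
    (L₂ := map p + map q + extend (prism p q) ∘ₗ boundary) (by simp [boundary_prism]) c
  simpa using this

lemma prism_mem (p q : V → W) (l : List V) :
    prism p q l ∈ Supp {l' | l'.length = l.length + 1 ∧
      ∀ x ∈ l', ∃ v ∈ l, x = p v ∨ x = q v} := by
  induction l with
  | nil => simp [prism]
  | cons v l ih =>
    refine Submodule.add_mem _ (single_mem ⟨by simp, ?_⟩) (apply_mem (fun l' hl' => ?_) ih)
    · intro x hx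
      simp only [List.mem_cons, List.mem_map] at hx ⊢
      grind
    · rw [cone_single]
      refine single_mem ⟨by simpa using hl'.1, ?_⟩
      intro x hx
      have := hl'.2
      simp only [List.mem_cons] at hx ⊢
      grind

/-- Subdivision of simplices with `k` vertices, a simplex `l` being coned from `b l`. -/
noncomputable def subdiv (b : List V → V) : ℕ → List V → Chain V
  | 0, l => Finsupp.single l 1
  | k + 1, l => cone (b l) (extend (subdiv b k) (faces l))

/-- The chain homotopy between the identity and `subdiv`. -/
noncomputable def subdivHomotopy (b : List V → V) : ℕ → List V → Chain V
  | 0, _ => 0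
  | k + 1, l => cone (b l) (Finsupp.single l 1 + extend (subdivHomotopy b k) (faces l))

lemma faces_mem_length {k : ℕ} {l : List V} (h : l.length = k + 1) :
    faces l ∈ Supp {l' : List V | l'.length = k} :=
  supp_mono (fun l' hl' => by have := hl'.1; simp only [Set.mem_ofPred_eq]; omega) (faces_mem l)

lemma boundary_extend_subdiv (b : List V → V) (k : ℕ) {c : Chain V}
    (hc : c ∈ Supp {l : List V | l.length = k}) :
    boundary (extend (subdiv b k) c) = extend (subdiv b (k - 1)) (boundary c) := by
  induction k generalizing c with
  | zero =>
    have := eq_of_mem (L₁ := boundary ∘ₗ extend (subdiv b 0))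
      (L₂ := extend (subdiv b 0) ∘ₗ boundary) (fun l hl => ?_) hc
    · rwa [LinearMap.comp_apply, LinearMap.comp_apply] at this
    · obtain rfl : l = [] := by simpa using hl
      simp [subdiv, faces]
  | succ k ih =>
    have := eq_of_mem (L₁ := boundary ∘ₗ extend (subdiv b (k + 1)))
      (L₂ := extend (subdiv b k) ∘ₗ boundary) (fun l hl => ?_) hc
    · rwa [LinearMap.comp_apply, LinearMap.comp_apply] at this
    · simp [subdiv, boundary_cone, ih (faces_mem_length hl), boundary_faces]

lemma boundary_extend_subdivHomotopy (b : List V → V) (k : ℕ) {c : Chain V}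
    (hc : c ∈ Supp {l : List V | l.length = k}) :
    boundary (extend (subdivHomotopy b k) c) =
      c + extend (subdivHomotopy b (k - 1)) (boundary c) + extend (subdiv b k) c := by
  induction k generalizing c with
  | zero =>
    refine eq_of_mem (L₁ := boundary ∘ₗ extend (subdivHomotopy b 0))
      (L₂ := LinearMap.id + extend (subdivHomotopy b 0) ∘ₗ boundary + extend (subdiv b 0))
      (fun l hl => ?_) hc
    obtain rfl : l = [] := by simpa using hl
    simp [subdiv, subdivHomotopy, faces, add_self]
  | succ k ih =>
    refine eq_of_mem (L₁ := boundary ∘ₗ extend (subdivHomotopy b (k + 1)))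
      (L₂ := LinearMap.id + extend (subdivHomotopy b k) ∘ₗ boundary + extend (subdiv b (k + 1)))
      (fun l hl => ?_) hc
    have h := add_self (cone (b l) (faces l))
    simp only [LinearMap.comp_apply, LinearMap.add_apply, extend_single, subdiv, subdivHomotopy,
      boundary_cone, map_add, boundary_single, ih (faces_mem_length hl), boundary_faces, map_zero,
      LinearMap.id_apply]
    linear_combination (norm := abel) h

/-- The sum of the values of `F` at all multisets obtained by removing one element. -/
def faceSum {L : Type*} [DecidableEq L] (F : Multiset L → ZMod 2) (M : Multiset L) : ZMod 2 :=
  (M.map fun x => F (M.erase x)).sum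

lemma faceSum_cons {L : Type*} [DecidableEq L] (F : Multiset L → ZMod 2) (x : L)
    (M : Multiset L) : faceSum F (x ::ₘ M) = F M + faceSum (fun N => F (x ::ₘ N)) M := by
  simp only [faceSum, Multiset.map_cons, Multiset.sum_cons, Multiset.erase_cons_head]
  congr 2
  refine Multiset.map_congr rfl fun y hy => ?_
  by_cases h : y = x
  · subst h
    simp [Multiset.cons_erase hy]
  · rw [Multiset.erase_cons_tail _ (fun h' => h h'.symm)]

lemma extend_faces {L : Type*} [DecidableEq L] (F : Multiset L → ZMod 2) (l : List L) :
    extend (fun l' : List L => F l') (faces l) = faceSum F l := by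
  induction l generalizing F with
  | nil => simp [faces, faceSum]
  | cons v l ih =>
    rw [← Multiset.cons_coe, faceSum_cons, ← ih, faces, map_add, extend_single]
    congr 1
    rw [← LinearMap.comp_apply]
    exact apply_eq_of_single (by simp) _

/-- The Fan cochain: `fan n s M` is `1` exactly when the labels in `M`, sorted by their index,
have distinct indices below `n` and alternating signs, the first of them being `s`. -/
def fan : ℕ → Bool → Multiset (ℕ × Bool) → ZMod 2
  | 0, _, M => if M = 0 then 1 else 0
  | n + 1, s, M =>
    if M.filter (fun x => x.1 = n) = 0 ∨
        M.filter (fun x => x.1 = n) =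
          {(n, xor s (decide (Odd (M.filter (fun x => x.1 ≠ n)).card)))} then
      fan n s (M.filter (fun x => x.1 ≠ n))
    else 0

lemma fan_zero (n : ℕ) (s : Bool) : fan n s 0 = 1 := by
  induction n with
  | zero => simp [fan]
  | succ n ih => simpa [fan] using ih

lemma fan_succ_of_forall_ne {n : ℕ} (s : Bool) {r : Multiset (ℕ × Bool)}
    (h : ∀ x ∈ r, x.1 ≠ n) : fan (n + 1) s r = fan n s r := by
  have h1 : r.filter (fun x => x.1 = n) = 0 := Multiset.filter_eq_nil.2 h
  have h2 : r.filter (fun x => x.1 ≠ n) = r := Multiset.filter_eq_self.2 h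
  simp only [fan, h1, h2, true_or, if_true]

lemma fan_succ_cons {n : ℕ} (s e : Bool) {r : Multiset (ℕ × Bool)}
    (h : ∀ x ∈ r, x.1 ≠ n) :
    fan (n + 1) s ((n, e) ::ₘ r) =
      if e = xor s (decide (Odd r.card)) then fan n s r else 0 := by
  have h1 : r.filter (fun x => x.1 = n) = 0 := Multiset.filter_eq_nil.2 h
  have h2 : r.filter (fun x => x.1 ≠ n) = r := Multiset.filter_eq_self.2 h
  have h3 : ((n, e) ::ₘ r).filter (fun x => x.1 = n) = {(n, e)} := by
    rw [Multiset.filter_cons_of_pos (p := fun x : ℕ × Bool => x.1 = n) _ rfl, h1]; rfl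
  have h4 : ((n, e) ::ₘ r).filter (fun x => x.1 ≠ n) = r := by
    rw [Multiset.filter_cons_of_neg _ (by simp), h2]
  simp only [fan, h3, h4, Multiset.singleton_ne_zero, false_or, Multiset.singleton_inj,
    Prod.mk.injEq, true_and]

lemma fan_succ_cons_cons (n : ℕ) (s e e' : Bool) (M : Multiset (ℕ × Bool)) :
    fan (n + 1) s ((n, e) ::ₘ (n, e') ::ₘ M) = 0 := by
  rw [fan, Multiset.filter_cons_of_pos (p := fun x : ℕ × Bool => x.1 = n) _ rfl,
    Multiset.filter_cons_of_pos (p := fun x : ℕ × Bool => x.1 = n) _ rfl, if_neg]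
  rintro (h | h)
  · simp at h
  · simpa using congrArg Multiset.card h

lemma fan_eq_zero_of_lt_card {n : ℕ} (s : Bool) {M : Multiset (ℕ × Bool)} (h : n < M.card) :
    fan n s M = 0 := by
  induction n generalizing M with
  | zero =>
    rw [fan, if_neg]
    rintro rfl
    simp at h
  | succ n ih =>
    rw [fan]
    split_ifs with h'
    · apply ih
      have := congrArg Multiset.card (Multiset.filter_add_not (fun x : ℕ × Bool => x.1 = n) M)
      rw [Multiset.card_add] at this
      have h1 : (M.filter (fun x => x.1 = n)).card ≤ 1 := by
        rcases h' with h' | h' <;> simp [h']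
      simp only [ne_eq]
      omega
    · rfl

lemma fan_map_not (n : ℕ) (s : Bool) (M : Multiset (ℕ × Bool)) :
    fan n s (M.map fun x => (x.1, !x.2)) = fan n (!s) M := by
  induction n generalizing M with
  | zero => simp [fan]
  | succ n ih =>
    simp only [fan, Multiset.filter_map, Function.comp_def, Multiset.card_map, ih,
      Multiset.map_eq_zero]
    congr 2
    rw [Multiset.map_eq_singleton]
    apply propext
    constructor
    · rintro ⟨⟨a, e⟩, h1, h2⟩
      rw [h1]
      simp only [Prod.mk.injEq] at h2
      obtain ⟨rfl, h2⟩ := h2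
      simp only [ne_eq] at *
      cases e <;> cases s <;> simp_all
    · intro h
      refine ⟨_, h, ?_⟩
      simp

/-- The coboundary relation of the Fan cochains. -/
lemma faceSum_fan {n : ℕ} (s : Bool) {M : Multiset (ℕ × Bool)} (hlt : ∀ x ∈ M, x.1 < n)
    (heq : ∀ x ∈ M, ∀ y ∈ M, x.1 = y.1 → x = y) :
    faceSum (fan n s) M = fan n true M + fan n false M := by
  induction n generalizing M with
  | zero =>
    obtain rfl : M = 0 := Multiset.eq_zero_of_forall_notMem fun x hx => by simpa using hlt x hx
    simp [faceSum, fan]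
    rfl
  | succ n ih =>
    have key : ∀ {r : Multiset (ℕ × Bool)}, r ≤ M → (∀ x ∈ r, x.1 ≠ n) →
        faceSum (fan n s) r = fan n true r + fan n false r := fun {r} hr hn =>
      ih (fun x hx => lt_of_le_of_ne (Nat.lt_succ_iff.1 (hlt x (Multiset.mem_of_le hr hx)))
        (hn x hx)) fun x hx y hy =>
          heq x (Multiset.mem_of_le hr hx) y (Multiset.mem_of_le hr hy)
    by_cases h0 : ∀ x ∈ M, x.1 ≠ n
    · rw [fan_succ_of_forall_ne _ h0, fan_succ_of_forall_ne _ h0, ← key le_rfl h0]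
      simp only [faceSum]
      congr 1
      refine Multiset.map_congr rfl fun y _ => fan_succ_of_forall_ne _ fun x hx => ?_
      exact h0 x (Multiset.mem_of_mem_erase hx)
    push Not at h0
    obtain ⟨⟨m, e⟩, hx, hm⟩ := h0
    obtain rfl : m = n := hm
    obtain ⟨r, rfl⟩ := Multiset.exists_cons_of_mem hx
    by_cases h1 : ∀ x ∈ r, x.1 ≠ m
    · have hr := key (Multiset.le_cons_self _ _) h1
      have hbool : ∀ (e s q : Bool) (a : ZMod 2),
          (if e = xor s q then a else 0) = if e = xor s (!q) then 0 else a := by decide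
      have hsum : faceSum (fun N => fan (m + 1) s ((m, e) ::ₘ N)) r =
          if e = xor s (decide (Odd r.card)) then 0 else faceSum (fan m s) r := by
        have : ∀ y ∈ r, fan (m + 1) s ((m, e) ::ₘ r.erase y) =
            if e = xor s (decide (Odd r.card)) then 0 else fan m s (r.erase y) := by
          intro y hy
          rw [fan_succ_cons _ _ fun x hx => h1 x (Multiset.mem_of_mem_erase hx)]
          have hc := Multiset.card_erase_add_one hy
          have hodd : decide (Odd r.card) = !decide (Odd (r.erase y).card) := by
            rw [← hc, ← decide_not, decide_eq_decide, Nat.odd_add_one]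
          rw [hodd]
          generalize decide (Odd (r.erase y).card) = q
          generalize fan m s (r.erase y) = a
          exact hbool e s q a
        rw [faceSum, Multiset.map_congr rfl this]
        split_ifs <;> simp [faceSum]
      rw [faceSum_cons, hsum, hr, fan_succ_of_forall_ne _ h1, fan_succ_cons _ _ h1,
        fan_succ_cons _ _ h1]
      generalize decide (Odd r.card) = q
      have hbool' : ∀ (e s q : Bool) (a a' : ZMod 2),
          (if s then a else a') + (if e = xor s q then 0 else a + a') =
            (if e = xor true q then a else 0) + (if e = xor false q then a' else 0) := by decide
      cases s
      · exact hbool' e false q _ _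
      · exact hbool' e true q _ _
    · push Not at h1
      obtain ⟨y, hy, hym⟩ := h1
      obtain rfl := heq _ (Multiset.mem_cons_self _ _) y (Multiset.mem_cons_of_mem hy) hym.symm
      obtain ⟨r, rfl⟩ := Multiset.exists_cons_of_mem hy
      have h2 : ∀ a : ZMod 2, a + a = 0 := by decide
      rw [faceSum_cons, faceSum_cons, ← add_assoc, h2, fan_succ_cons_cons, fan_succ_cons_cons]
      simp [faceSum, fan_succ_cons_cons]

section Convex

variable {E : Type*} [NormedAddCommGroup E] [NormedSpace ℝ E]

/-- The simplices with `k` vertices and diameter at most `ε`. -/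
def Fine (V : Type*) [PseudoMetricSpace V] (k : ℕ) (ε : ℝ) : Set (List V) :=
  {l | l.length = k ∧ ∀ x ∈ l, ∀ y ∈ l, dist x y ≤ ε}

lemma Fine.mono {V : Type*} [PseudoMetricSpace V] {k : ℕ} {ε ε' : ℝ} (h : ε ≤ ε') :
    Fine V k ε ⊆ Fine V k ε' :=
  fun _ hl => ⟨hl.1, fun x hx y hy => (hl.2 x hx y hy).trans h⟩

/-- The barycenter of a list of vectors. -/
noncomputable def bary (l : List E) : E := (l.length : ℝ)⁻¹ • l.sum

lemma norm_sum_sub_le {l : List E} {v : E} {d : ℝ} (h : ∀ x ∈ l, ‖x - v‖ ≤ d) :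
    ‖l.sum - (l.length : ℝ) • v‖ ≤ l.length * d := by
  induction l with
  | nil => simp
  | cons a l ih =>
    have h1 := ih fun x hx => h x (List.mem_cons_of_mem _ hx)
    have h2 := h a List.mem_cons_self
    have h3 : (a :: l).sum - ((a :: l).length : ℝ) • v =
        (a - v) + (l.sum - (l.length : ℝ) • v) := by
      simp only [List.sum_cons, List.length_cons, Nat.cast_add, Nat.cast_one]
      module
    rw [h3]
    refine (norm_add_le _ _).trans ?_
    simp only [List.length_cons, Nat.cast_add, Nat.cast_one]
    linarith

lemma dist_bary_le {l : List E} {v : E} {d : ℝ} {N : ℕ} (hv : v ∈ l) (hN : l.length ≤ N)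
    (h : ∀ x ∈ l, ∀ y ∈ l, dist x y ≤ d) : dist v (bary l) ≤ (1 - (N : ℝ)⁻¹) * d := by
  classical
  have hd : 0 ≤ d := dist_nonneg.trans (h v hv v hv)
  have hperm := List.perm_cons_erase hv
  have hsum : l.sum = v + (l.erase v).sum := by rw [hperm.sum_eq, List.sum_cons]
  have hlen : l.length = (l.erase v).length + 1 := by rw [hperm.length_eq, List.length_cons]
  have h1 : ‖(l.erase v).sum - ((l.erase v).length : ℝ) • v‖ ≤ (l.erase v).length * d :=
    norm_sum_sub_le fun x hx => by
      rw [← dist_eq_norm]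
      exact h x (List.mem_of_mem_erase hx) v hv
  have hpos : (0 : ℝ) < l.length := by rw [hlen]; positivity
  have h2 : bary l - v = (l.length : ℝ)⁻¹ • ((l.erase v).sum - ((l.erase v).length : ℝ) • v) := by
    have : v = (l.length : ℝ)⁻¹ • ((l.length : ℝ) • v) := by
      rw [smul_smul, inv_mul_cancel₀ hpos.ne', one_smul]
    conv_lhs => rw [this]
    rw [bary, ← smul_sub, hsum, hlen]
    push_cast
    congr 1
    module
  rw [dist_comm, dist_eq_norm, h2, norm_smul, norm_inv, Real.norm_natCast]
  calc (l.length : ℝ)⁻¹ * ‖(l.erase v).sum - ((l.erase v).length : ℝ) • v‖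
      ≤ (l.length : ℝ)⁻¹ * ((l.erase v).length * d) := by gcongr
    _ = (1 - (l.length : ℝ)⁻¹) * d := by
        have : ((l.erase v).length : ℝ) = l.length - 1 := by rw [hlen]; push_cast; ring
        rw [this]
        field_simp
    _ ≤ (1 - (N : ℝ)⁻¹) * d := by gcongr

lemma bary_mem {l : List E} (hl : l ≠ []) {K : Set E} (hK : Convex ℝ K) (h : ∀ x ∈ l, x ∈ K) :
    bary l ∈ K := by
  have hpos : (0 : ℝ) < l.length := by
    exact_mod_cast List.length_pos_of_ne_nil hl
  have : bary l = ∑ i : Fin l.length, (l.length : ℝ)⁻¹ • l.get i := by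
    rw [bary, ← Finset.smul_sum, ← List.sum_ofFn, List.ofFn_get]
  rw [this]
  refine hK.sum_mem (fun _ _ => by positivity) ?_ fun i _ => h _ (List.get_mem _ _)
  simp [ne_of_gt hpos]

/-- The convex hull of the vertices of a simplex. -/
abbrev hull (l : List E) : Set E := convexHull ℝ {x | x ∈ l}

lemma hull_mono {l l' : List E} (h : l ⊆ l') : hull l ⊆ hull l' :=
  convexHull_mono fun _ hx => h hx

lemma subset_hull {l : List E} {x : E} (hx : x ∈ l) : x ∈ hull l :=
  subset_convexHull ℝ _ hx

lemma dist_le_of_mem_hull {l : List E} {a x : E} {d : ℝ} (h : ∀ y ∈ l, dist y a ≤ d)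
    (hx : x ∈ hull l) : dist x a ≤ d :=
  convexHull_min (t := Metric.closedBall a d) (fun y hy => h y hy) (convex_closedBall a d) hx

lemma subdiv_mem {k N : ℕ} (hk : k ≤ N) {d : ℝ} {l : List E} (hl : l ∈ Fine E k d) :
    subdiv bary k l ∈ Supp {l' | l' ∈ Fine E k ((1 - (N : ℝ)⁻¹) * d) ∧ ∀ x ∈ l', x ∈ hull l} := by
  induction k generalizing l with
  | zero =>
    obtain rfl : l = [] := by simpa using hl.1
    exact single_mem (by simp [Fine])
  | succ k ih =>
    have hne : l ≠ [] := by
      rintro rfl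
      simpa using hl.1
    have hd : 0 ≤ d := by
      obtain ⟨a, ha⟩ := List.exists_mem_of_ne_nil l hne
      exact dist_nonneg.trans (hl.2 a ha a ha)
    refine apply_mem (A := {l' | l' ∈ Fine E k ((1 - (N : ℝ)⁻¹) * d) ∧ ∀ x ∈ l', x ∈ hull l})
      (fun l' hl' => ?_) (apply_mem (fun l' hl' => ?_) (faces_mem l))
    · rw [cone_single]
      have hb : ∀ x ∈ l', dist x (bary l) ≤ (1 - (N : ℝ)⁻¹) * d := fun x hx =>
        dist_le_of_mem_hull (fun y hy => dist_bary_le hy (hl.1.trans_le hk) hl.2) (hl'.2 x hx)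
      have h0 : 0 ≤ (1 - (N : ℝ)⁻¹) * d := mul_nonneg (sub_nonneg.2 (Nat.cast_inv_le_one _)) hd
      refine single_mem ⟨⟨by simpa using hl'.1.1, ?_⟩, ?_⟩
      · intro x hx y hy
        rcases List.mem_cons.1 hx with rfl | hx <;> rcases List.mem_cons.1 hy with rfl | hy
        · simpa using h0
        · rw [dist_comm]; exact hb y hy
        · exact hb x hx
        · exact hl'.1.2 x hx y hy
      · intro x hx
        rcases List.mem_cons.1 hx with rfl | hx
        · exact bary_mem hne (convex_convexHull ℝ _) fun x hx => subset_hull hx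
        · exact hl'.2 x hx
    · rw [extend_single]
      have hlen := hl'.1
      have hlen' := hl.1
      refine supp_mono ?_ (ih (by omega)
        ⟨by omega, fun x hx y hy => hl.2 x (hl'.2 hx) y (hl'.2 hy)⟩)
      exact fun l'' hl'' => ⟨hl''.1, fun x hx => hull_mono hl'.2 (hl''.2 x hx)⟩

lemma subdivHomotopy_mem {k : ℕ} {d : ℝ} {l : List E} (hl : l ∈ Fine E k d) :
    subdivHomotopy bary k l ∈ Supp {l' | l' ∈ Fine E (k + 1) d ∧ ∀ x ∈ l', x ∈ hull l} := by
  have key : subdivHomotopy bary k l ∈ Supp {l' | l'.length = k + 1 ∧ ∀ x ∈ l', x ∈ hull l} := by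
    replace hl := hl.1
    induction k generalizing l with
    | zero => exact Submodule.zero_mem _
    | succ k ih =>
      have hne : l ≠ [] := by
        rintro rfl
        simp at hl
      refine apply_mem (A := {l' | l'.length = k + 1 ∧ ∀ x ∈ l', x ∈ hull l})
        (fun l' hl' => ?_) (Submodule.add_mem _ ?_ (apply_mem (fun l' hl' => ?_) (faces_mem l)))
      · rw [cone_single]
        refine single_mem ⟨by simpa using hl'.1, ?_⟩
        intro x hx
        rcases List.mem_cons.1 hx with rfl | hx
        · exact bary_mem hne (convex_convexHull ℝ _) fun x hx => subset_hull hx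
        · exact hl'.2 x hx
      · exact single_mem ⟨hl, fun x hx => subset_hull hx⟩
      · rw [extend_single]
        have hlen := hl'.1
        refine supp_mono ?_ (ih (by omega))
        exact fun l'' hl'' => ⟨hl''.1, fun x hx => hull_mono hl'.2 (hl''.2 x hx)⟩
  refine supp_mono ?_ key
  refine fun l' hl' => ⟨⟨hl'.1, fun x hx y hy => ?_⟩, hl'.2⟩
  refine dist_le_of_mem_hull (fun a ha => ?_) (hl'.2 x hx)
  rw [dist_comm]
  exact dist_le_of_mem_hull (fun b hb => hl.2 b hb a ha) (hl'.2 y hy)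

/-- The fine simplices contained in some convex set at distance at least `ρ` from the origin. -/
def Avoid (E : Type*) [NormedAddCommGroup E] [NormedSpace ℝ E] (ρ : ℝ) (k : ℕ) (d : ℝ) :
    Set (List E) :=
  {l | l ∈ Fine E k d ∧ ∃ K, Convex ℝ K ∧ (∀ x ∈ K, ρ ≤ ‖x‖) ∧ ∀ x ∈ l, x ∈ K}

lemma Avoid.mono {ρ : ℝ} {k : ℕ} {d d' : ℝ} (h : d ≤ d') : Avoid E ρ k d ⊆ Avoid E ρ k d' :=
  fun _ hl => ⟨Fine.mono h hl.1, hl.2⟩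

lemma extend_subdiv_mem {ρ d : ℝ} {k N : ℕ} (hk : k ≤ N) {c : Chain E}
    (hc : c ∈ Supp (Avoid E ρ k d)) :
    extend (subdiv bary k) c ∈ Supp (Avoid E ρ k ((1 - (N : ℝ)⁻¹) * d)) := by
  refine apply_mem (fun l hl => ?_) hc
  rw [extend_single]
  obtain ⟨hl, K, hK, hKρ, hlK⟩ := hl
  refine supp_mono ?_ (subdiv_mem hk hl)
  exact fun l' hl' => ⟨hl'.1, K, hK, hKρ, fun x hx => convexHull_min hlK hK (hl'.2 x hx)⟩

lemma extend_subdivHomotopy_mem {ρ d : ℝ} {k : ℕ} {c : Chain E}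
    (hc : c ∈ Supp (Avoid E ρ k d)) :
    extend (subdivHomotopy bary k) c ∈ Supp (Avoid E ρ (k + 1) d) := by
  refine apply_mem (fun l hl => ?_) hc
  rw [extend_single]
  obtain ⟨hl, K, hK, hKρ, hlK⟩ := hl
  refine supp_mono ?_ (subdivHomotopy_mem hl)
  exact fun l' hl' => ⟨hl'.1, K, hK, hKρ, fun x hx => convexHull_min hlK hK (hl'.2 x hx)⟩

lemma length_eq_of_mem_avoid {ρ d : ℝ} {k : ℕ} {l : List E} (hl : l ∈ Avoid E ρ k d) :
    l.length = k :=
  hl.1.1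

/-- A chain can be subdivided finely, its boundary moving only by a small homotopy. -/
lemma exists_subdivision {ρ ρ' D d : ℝ} {k : ℕ} (hd : 0 ≤ d) {y : Chain E}
    (hy : y ∈ Supp (Avoid E ρ (k + 1) D)) (hz : boundary y ∈ Supp (Avoid E ρ' k d)) (m : ℕ) :
    ∃ y' ∈ Supp (Avoid E ρ (k + 1) ((1 - ((k + 1 : ℕ) : ℝ)⁻¹) ^ m * D)),
      boundary y' ∈ Supp (Avoid E ρ' k d) ∧
      ∃ t ∈ Supp (Avoid E ρ' (k + 1) d), boundary t = boundary y + boundary y' := by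
  induction m with
  | zero =>
    refine ⟨y, by simpa using hy, hz, 0, Submodule.zero_mem _, ?_⟩
    rw [add_self, map_zero]
  | succ m ih =>
    obtain ⟨y', hy', hz', t, ht, htb⟩ := ih
    have hb : boundary (extend (subdiv bary (k + 1)) y') = extend (subdiv bary k) (boundary y') :=
      boundary_extend_subdiv bary (k + 1) (supp_mono (fun l hl => length_eq_of_mem_avoid hl) hy')
    have hT := boundary_extend_subdivHomotopy bary k
      (supp_mono (fun l hl => length_eq_of_mem_avoid hl) hz')
    rw [boundary_boundary, map_zero, add_zero] at hT
    refine ⟨extend (subdiv bary (k + 1)) y', ?_, ?_,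
      t + extend (subdivHomotopy bary k) (boundary y'),
      Submodule.add_mem _ ht (extend_subdivHomotopy_mem hz'), ?_⟩
    · rw [pow_succ', mul_assoc]
      exact extend_subdiv_mem le_rfl hy'
    · rw [hb]
      refine supp_mono (Avoid.mono ?_) (extend_subdiv_mem (Nat.le_succ k) hz')
      refine mul_le_of_le_one_left hd ?_
      simp only [sub_le_self_iff]
      positivity
    · rw [map_add, hT, htb, hb]
      have h := add_self (boundary y')
      linear_combination (norm := abel) h

lemma exists_apex [FiniteDimensional ℝ E] (A : Finset (List E)) {k : ℕ}
    (hk : k < Module.finrank ℝ E) (hA : ∀ l ∈ A, l.length = k) :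
    ∃ p : E, ∀ l ∈ A, p ∉ Submodule.span ℝ {x | x ∈ l} := by
  classical
  have h : ⊤ ∉ A.image fun l => Submodule.span ℝ {x | x ∈ l} := by
    intro h
    obtain ⟨l, hl, h⟩ := Finset.mem_image.1 h
    have h1 : {x | x ∈ l} = (l.toFinset : Set E) := by ext; simp
    have h2 := finrank_span_finset_le_card (R := ℝ) l.toFinset
    rw [← h1, Set.finrank, h, finrank_top] at h2
    have h3 := l.toFinset_card_le
    have h4 := hA l hl
    omega
  have h' := Subspace.biUnion_ne_univ_of_top_notMem h
  obtain ⟨p, hp⟩ := (Set.ne_univ_iff_exists_notMem _).1 h'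
  refine ⟨p, fun l hl hpl => hp ?_⟩
  simp only [Set.mem_iUnion]
  exact ⟨_, Finset.mem_image_of_mem _ hl, hpl⟩

lemma zero_notMem_hull_cons {p : E} {l : List E} (hp : p ∉ Submodule.span ℝ {x | x ∈ l})
    (h0 : (0 : E) ∉ hull l) : (0 : E) ∉ hull (p :: l) := by
  have hins : {x | x ∈ p :: l} = insert p {x | x ∈ l} := by ext; simp
  rw [hull, hins]
  rcases Set.eq_empty_or_nonempty {x | x ∈ l} with h | h
  · rw [h] at hp ⊢
    simpa [eq_comm] using hp
  · rw [convexHull_insert h, mem_convexJoin]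
    rintro ⟨q, hq, y, hy, a, b, -, -, hab, h⟩
    obtain rfl : q = p := hq
    have hys : y ∈ Submodule.span ℝ {x | x ∈ l} :=
      convexHull_min Submodule.subset_span (Submodule.convex _) hy
    by_cases ha : a = 0
    · subst ha
      obtain rfl : b = 1 := by simpa using hab
      obtain rfl : y = 0 := by simpa using h
      exact h0 hy
    · apply hp
      have hq : q = (-(a⁻¹ * b)) • y := by
        have h1 : a⁻¹ • (a • q + b • y) = 0 := by rw [h, smul_zero]
        rw [smul_add, smul_smul, smul_smul, inv_mul_cancel₀ ha, one_smul] at h1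
        rw [neg_smul]
        exact eq_neg_of_add_eq_zero_left h1
      rw [hq]
      exact Submodule.smul_mem _ _ hys

/-- Finitely many simplices whose hulls omit the origin stay uniformly away from it. -/
lemma exists_subset_avoid (A : Finset (List E)) {k : ℕ} (hA : ∀ l ∈ A, l.length = k)
    (h0 : ∀ l ∈ A, (0 : E) ∉ hull l) : ∃ ρ > 0, ∃ D, (A : Set (List E)) ⊆ Avoid E ρ k D := by
  have hK : IsCompact (⋃ l ∈ A, hull l) :=
    A.isCompact_biUnion fun l _ => (List.finite_toSet l).isCompact_convexHull ℝ
  have h0K : (0 : E) ∈ (⋃ l ∈ A, hull l)ᶜ := by simpa using h0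
  obtain ⟨ρ, hρ, hball⟩ := Metric.isOpen_iff.1 hK.isClosed.isOpen_compl 0 h0K
  obtain ⟨D, hD⟩ := Metric.isBounded_iff.1 hK.isBounded
  have hsub : ∀ l ∈ A, hull l ⊆ ⋃ l ∈ A, hull l := fun l hl =>
    Set.subset_biUnion_of_mem (u := fun l => hull l) hl
  refine ⟨ρ, hρ, D, fun l hl => ⟨⟨hA l hl, fun x hx y hy =>
    hD (hsub l hl (subset_hull hx)) (hsub l hl (subset_hull hy))⟩, hull l, convex_convexHull ℝ _,
    fun x hx => ?_, fun x hx => subset_hull hx⟩⟩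
  by_contra! h
  exact hball (mem_ball_zero_iff.2 h) (hsub l hl hx)

open Classical in
/-- Radial projection to the unit sphere, with `s` as value at the origin. -/
noncomputable def radial (s : Metric.sphere (0 : E) 1) (x : E) : Metric.sphere (0 : E) 1 :=
  if h : x = 0 then s else ⟨‖x‖⁻¹ • x, by simp [norm_smul, h]⟩

lemma radial_coe (s x : Metric.sphere (0 : E) 1) : radial s (x : E) = x := by
  have hx : ‖(x : E)‖ = 1 := by simp
  have : (x : E) ≠ 0 := by
    rw [← norm_ne_zero_iff, hx]
    exact one_ne_zero
  ext
  simp [radial, this]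

lemma dist_radial_le (s : Metric.sphere (0 : E) 1) {ρ : ℝ} (hρ : 0 < ρ) {x y : E} (hx : ρ ≤ ‖x‖)
    (hy : ρ ≤ ‖y‖) : dist (radial s x) (radial s y) ≤ 2 * dist x y / ρ := by
  have hx0 : 0 < ‖x‖ := hρ.trans_le hx
  have hy0 : 0 < ‖y‖ := hρ.trans_le hy
  rw [Subtype.dist_eq, radial, radial, dif_neg (norm_pos_iff.1 hx0), dif_neg (norm_pos_iff.1 hy0),
    dist_eq_norm, dist_eq_norm]
  have h1 : ‖x‖⁻¹ • x - ‖y‖⁻¹ • y = ‖x‖⁻¹ • (x - y) + (‖x‖⁻¹ * (‖y‖ - ‖x‖)) • (‖y‖⁻¹ • y) := by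
    rw [smul_smul, show ‖x‖⁻¹ * (‖y‖ - ‖x‖) * ‖y‖⁻¹ = ‖x‖⁻¹ - ‖y‖⁻¹ by field_simp]
    module
  have h2 : ‖‖y‖⁻¹ • y‖ = 1 := by
    rw [norm_smul, norm_inv, norm_norm, inv_mul_cancel₀ hy0.ne']
  have h3 : |‖y‖ - ‖x‖| ≤ ‖x - y‖ := by
    rw [abs_sub_comm]
    exact abs_norm_sub_norm_le x y
  rw [h1]
  refine (norm_add_le _ _).trans ?_
  rw [norm_smul, norm_smul, h2, mul_one, norm_mul, norm_inv, norm_norm, Real.norm_eq_abs]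
  calc ‖x‖⁻¹ * ‖x - y‖ + ‖x‖⁻¹ * |‖y‖ - ‖x‖| ≤ ‖x‖⁻¹ * ‖x - y‖ + ‖x‖⁻¹ * ‖x - y‖ := by gcongr
    _ = 2 * ‖x - y‖ / ‖x‖ := by ring
    _ ≤ 2 * ‖x - y‖ / ρ := by gcongr

lemma map_radial_mem (s : Metric.sphere (0 : E) 1) {ρ d ε : ℝ} {k : ℕ} (hρ : 0 < ρ)
    (h : 2 * d / ρ ≤ ε) {c : Chain E} (hc : c ∈ Supp (Avoid E ρ k d)) :
    map (radial s) c ∈ Supp (Fine (Metric.sphere (0 : E) 1) k ε) := by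
  refine apply_mem (fun l hl => ?_) hc
  rw [map_single]
  obtain ⟨hl, K, -, hK, hlK⟩ := hl
  refine single_mem ⟨by simpa using hl.1, ?_⟩
  simp only [List.mem_map, forall_exists_index, and_imp, forall_apply_eq_imp_iff₂]
  intro x hx y hy
  refine (dist_radial_le s hρ (hK x (hlK x hx)) (hK y (hlK y hy))).trans (le_trans ?_ h)
  have := hl.2 x hx y hy
  gcongr

/-- Fine cycles of low dimension on the sphere bound fine chains. -/
lemma exists_boundary_eq [FiniteDimensional ℝ E] (s : Metric.sphere (0 : E) 1) {k : ℕ}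
    (hk : k < Module.finrank ℝ E) {ε : ℝ} (hε : 0 < ε) (hε2 : ε ≤ 2)
    {z : Chain (Metric.sphere (0 : E) 1)}
    (hz : z ∈ Supp (Fine (Metric.sphere (0 : E) 1) k (ε / 4))) (hz0 : boundary z = 0) :
    ∃ w ∈ Supp (Fine (Metric.sphere (0 : E) 1) (k + 1) ε), boundary w = z := by
  set z₁ : Chain E := map Subtype.val z with hz₁
  have hz₁A : z₁ ∈ Supp (Avoid E (1 / 2) k (ε / 4)) := by
    refine apply_mem (fun l hl => ?_) hz
    rw [map_single]
    refine single_mem ⟨⟨by simpa using hl.1, ?_⟩, ?_⟩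
    · simp only [List.mem_map, forall_exists_index, and_imp, forall_apply_eq_imp_iff₂]
      intro x hx y hy
      exact hl.2 x hx y hy
    · rcases l with _ | ⟨a, l⟩
      · exact ⟨∅, convex_empty, by simp, by simp⟩
      · refine ⟨Metric.closedBall (a : E) (1 / 2), convex_closedBall _ _, fun x hx => ?_, ?_⟩
        · have h1 : ‖(a : E)‖ = 1 := by simp
          have h2 : ‖x - (a : E)‖ ≤ 1 / 2 := mem_closedBall_iff_norm.1 hx
          have h3 := norm_sub_norm_le (a : E) x
          rw [norm_sub_rev] at h3
          linarith
        · simp only [List.mem_map, forall_exists_index, and_imp, forall_apply_eq_imp_iff₂]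
          intro x hx
          have : dist (x : E) (a : E) ≤ ε / 4 := hl.2 x hx a List.mem_cons_self
          rw [Metric.mem_closedBall]
          linarith
  have hz₁0 : boundary z₁ = 0 := by rw [hz₁, boundary_map, hz0, map_zero]
  have hmem : ∀ l ∈ z₁.support, l ∈ Avoid E (1 / 2) k (ε / 4) := fun l hl =>
    (Finsupp.mem_supported _ _).1 hz₁A hl
  obtain ⟨p, hp⟩ := exists_apex z₁.support hk fun l hl => length_eq_of_mem_avoid (hmem l hl)
  classical
  obtain ⟨ρ, hρ, D, hD⟩ := exists_subset_avoid (z₁.support.image (List.cons p)) (k := k + 1)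
    (by
      intro l hl
      obtain ⟨l, hl', rfl⟩ := Finset.mem_image.1 hl
      simpa using length_eq_of_mem_avoid (hmem l hl'))
    (by
      intro l hl
      obtain ⟨l, hl', rfl⟩ := Finset.mem_image.1 hl
      refine zero_notMem_hull_cons (hp l hl') fun h => ?_
      obtain ⟨-, K, hK, hKρ, hlK⟩ := hmem l hl'
      have := hKρ 0 (convexHull_min hlK hK h)
      norm_num at this)
  have hy : cone p z₁ ∈ Supp (Avoid E ρ (k + 1) D) := by
    refine apply_mem (fun l hl => ?_) (Finsupp.mem_supported_support (ZMod 2) z₁)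
    rw [cone_single]
    exact single_mem (hD (Finset.mem_coe.2 (Finset.mem_image_of_mem _ hl)))
  have hyb : boundary (cone p z₁) = z₁ := by rw [boundary_cone, hz₁0, map_zero, add_zero]
  have hlim : Filter.Tendsto (fun m : ℕ => 2 * ((1 - ((k + 1 : ℕ) : ℝ)⁻¹) ^ m * D) / ρ)
      Filter.atTop (nhds (2 * (0 * D) / ρ)) := by
    refine ((Filter.Tendsto.mul_const D ?_).const_mul 2).div_const ρ
    refine tendsto_pow_atTop_nhds_zero_of_lt_one (sub_nonneg.2 (Nat.cast_inv_le_one _)) ?_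
    simp only [sub_lt_self_iff]
    positivity
  obtain ⟨m, hm⟩ := (hlim.eventually_le_const (u := ε) (by simpa using hε)).exists
  obtain ⟨y', hy', -, t, ht, htb⟩ := exists_subdivision (ρ' := 1 / 2) (d := ε / 4)
    (by positivity) hy (by rwa [hyb]) m
  refine ⟨map (radial s) (t + y'), ?_, ?_⟩
  · rw [map_add]
    refine Submodule.add_mem _ (map_radial_mem s (by norm_num) ?_ ht) (map_radial_mem s hρ hm hy')
    apply le_of_eq
    ring
  · rw [boundary_map, map_add, htb, hyb, add_assoc, add_self, add_zero, hz₁, map_map]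
    convert map_id z
    ext1 x
    exact radial_coe s x

end Convex

section Tower

variable {V : Type*} [PseudoMetricSpace V]

/-- `Tower f ε k c` says that `c` is the top of a tower of fine chains, starting from a point, in
which every chain has boundary `c' + f c'` with `c'` the chain one level below. -/
def Tower (f : V → V) (ε : ℝ) : ℕ → Chain V → Prop
  | 0, c => c ∈ Supp (Fine V 1 ε) ∧ boundary c = Finsupp.single [] 1
  | k + 1, c => c ∈ Supp (Fine V (k + 2) ε) ∧
      ∃ c', Tower f ε k c' ∧ boundary c = c' + map f c'

lemma Tower.mem {f : V → V} {ε : ℝ} {k : ℕ} {c : Chain V} (h : Tower f ε k c) :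
    c ∈ Supp (Fine V (k + 1) ε) := by
  cases k <;> exact h.1

lemma Tower.mono {f : V → V} {ε ε' : ℝ} (hε : ε ≤ ε') {k : ℕ} {c : Chain V}
    (h : Tower f ε k c) : Tower f ε' k c := by
  induction k generalizing c with
  | zero => exact ⟨supp_mono (Fine.mono hε) h.1, h.2⟩
  | succ k ih =>
    obtain ⟨h1, c', h2, h3⟩ := h
    exact ⟨supp_mono (Fine.mono hε) h1, c', ih h2, h3⟩

lemma Tower.boundary_add {f : V → V} (hf : f ∘ f = id) {ε : ℝ} {k : ℕ} {c : Chain V}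
    (h : Tower f ε k c) : boundary (c + map f c) = 0 := by
  rw [map_add, boundary_map]
  cases k with
  | zero => rw [h.2, map_single, List.map_nil, add_self]
  | succ k =>
    obtain ⟨-, c', -, h⟩ := h
    rw [h, map_add, map_map, hf, map_id, add_comm (map f c'), add_self]

lemma exists_add_map_mem {f : V → V} (hf : UniformContinuous f) {ε : ℝ} (hε : 0 < ε) :
    ∃ η > 0, η ≤ ε ∧ ∀ {k : ℕ} {c : Chain V}, c ∈ Supp (Fine V k η) →
      c + map f c ∈ Supp (Fine V k ε) := by
  obtain ⟨δ, hδ, hfδ⟩ := Metric.uniformContinuous_iff.1 hf ε hε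
  refine ⟨min (δ / 2) ε, by positivity, min_le_right _ _, fun hc => ?_⟩
  refine Submodule.add_mem _ (supp_mono (Fine.mono (min_le_right _ _)) hc)
    (apply_mem (fun l hl => ?_) hc)
  rw [map_single]
  refine single_mem ⟨by simpa using hl.1, ?_⟩
  intro x hx y hy
  obtain ⟨a, ha, rfl⟩ := List.mem_map.1 hx
  obtain ⟨b, hb, rfl⟩ := List.mem_map.1 hy
  have h1 := (hl.2 a ha b hb).trans (min_le_left _ _)
  exact (hfδ (by linarith)).le

lemma exists_tower {E : Type*} [NormedAddCommGroup E] [NormedSpace ℝ E] [FiniteDimensional ℝ E]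
    {f : Metric.sphere (0 : E) 1 → Metric.sphere (0 : E) 1} (hf : Continuous f)
    (hinv : f ∘ f = id) (s : Metric.sphere (0 : E) 1) {k : ℕ} (hk : k < Module.finrank ℝ E)
    {ε : ℝ} (hε : 0 < ε) : ∃ c, Tower f ε k c := by
  induction k generalizing ε with
  | zero =>
    refine ⟨Finsupp.single [s] 1, single_mem ⟨rfl, ?_⟩, by simp [faces]⟩
    simpa using hε.le
  | succ k ih =>
    obtain ⟨η, hη, hηε, hadd⟩ := exists_add_map_mem
      (CompactSpace.uniformContinuous_of_continuous hf) (ε := min ε 2 / 4) (by positivity)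
    obtain ⟨c, hc⟩ := ih (by omega) hη
    obtain ⟨w, hw, hwz⟩ := exists_boundary_eq s hk (by positivity) (min_le_right ε 2)
      (hadd hc.mem) (hc.boundary_add hinv)
    refine ⟨w, supp_mono (Fine.mono (min_le_left _ _)) hw, c, hc.mono ?_, hwz⟩
    have h1 := min_le_left ε 2
    linarith

end Tower

/-- Evaluation of the Fan cochain on chains of labels. -/
noncomputable def fanEval (n : ℕ) (s : Bool) : Chain (ℕ × Bool) →ₗ[ZMod 2] ZMod 2 :=
  extend fun l => fan n s l

/-- The simplices of labels with indices below `n` and without two labels of the same index and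
opposite signs. -/
def Compatible (n : ℕ) : Set (List (ℕ × Bool)) :=
  {l | (∀ x ∈ l, x.1 < n) ∧ ∀ x ∈ l, ∀ y ∈ l, x.1 = y.1 → x = y}

lemma fanEval_boundary (n : ℕ) (s : Bool) {c : Chain (ℕ × Bool)} (hc : c ∈ Supp (Compatible n)) :
    fanEval n s (boundary c) = fanEval n true c + fanEval n false c := by
  have := eq_of_mem (L₁ := fanEval n s ∘ₗ boundary) (L₂ := fanEval n true + fanEval n false)
    (fun l hl => ?_) hc
  · simpa using this
  · simp only [LinearMap.comp_apply, boundary_single, LinearMap.add_apply]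
    simp only [fanEval, extend_single, extend_faces]
    exact faceSum_fan s (M := (l : Multiset (ℕ × Bool))) (by simpa using hl.1)
      (by simpa using hl.2)

lemma fanEval_eq_zero {n : ℕ} (s : Bool) {c : Chain (ℕ × Bool)}
    (hc : c ∈ Supp {l : List (ℕ × Bool) | n < l.length}) : fanEval n s c = 0 := by
  refine eq_of_mem (L₁ := fanEval n s) (L₂ := 0) (fun l hl => ?_) hc
  simp only [fanEval, extend_single, LinearMap.zero_apply]
  exact fan_eq_zero_of_lt_card s (by simpa using hl)

lemma fanEval_map_not (n : ℕ) (s : Bool) (c : Chain (ℕ × Bool)) :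
    fanEval n s (map (fun x => (x.1, !x.2)) c) = fanEval n (!s) c := by
  rw [← LinearMap.comp_apply]
  refine apply_eq_of_single (fun l => ?_) c
  simp only [fanEval, LinearMap.comp_apply, map_single, extend_single]
  rw [← fan_map_not, Multiset.map_coe]

section Label

variable {V : Type*} [PseudoMetricSpace V] {n : ℕ} {ε : ℝ} {L L' : V → ℕ × Bool}

/-- Fan's parity theorem for labellings that are odd with respect to `f`. -/
lemma Tower.fanEval_add {f : V → V} (hL : ∀ v, L (f v) = ((L v).1, !(L v).2))
    (hlt : ∀ v, (L v).1 < n) (hcomp : ∀ u v, dist u v ≤ ε → (L u).1 = (L v).1 → L u = L v)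
    {k : ℕ} {c : Chain V} (h : Tower f ε k c) :
    fanEval n true (map L c) + fanEval n false (map L c) = 1 := by
  have hmem : ∀ {k : ℕ} {c : Chain V}, Tower f ε k c → map L c ∈ Supp (Compatible n) := by
    intro k c h
    refine apply_mem (fun l hl => ?_) h.mem
    rw [map_single]
    refine single_mem ⟨?_, ?_⟩
    · intro x hx
      obtain ⟨a, -, rfl⟩ := List.mem_map.1 hx
      exact hlt a
    · intro x hx y hy
      obtain ⟨a, ha, rfl⟩ := List.mem_map.1 hx
      obtain ⟨b, hb, rfl⟩ := List.mem_map.1 hy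
      exact hcomp a b (hl.2 a ha b hb)
  rw [← fanEval_boundary n true (hmem h), boundary_map]
  induction k generalizing c with
  | zero => rw [h.2, map_single, fanEval, extend_single]; exact fan_zero n true
  | succ k ih =>
    obtain ⟨-, c', h, hb⟩ := h
    have hnot : map L (map f c') = map (fun x => (x.1, !x.2)) (map L c') := by
      rw [map_map, map_map]
      congr 2
      exact funext hL
    rw [hb, map_add, map_add, hnot, fanEval_map_not, Bool.not_true,
      ← fanEval_boundary n true (hmem h), boundary_map, ih h]

/-- The Fan cochain takes the same value on a cycle for two labellings that are compatible on
close points. -/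
lemma fanEval_map_eq (hlt : ∀ v, (L v).1 < n) (hlt' : ∀ v, (L' v).1 < n)
    (h₁ : ∀ u v, dist u v ≤ ε → (L u).1 = (L v).1 → L u = L v)
    (h₂ : ∀ u v, dist u v ≤ ε → (L u).1 = (L' v).1 → L u = L' v)
    (h₃ : ∀ u v, dist u v ≤ ε → (L' u).1 = (L' v).1 → L' u = L' v)
    {z : Chain V} (hz : z ∈ Supp (Fine V n ε)) (hz0 : boundary z = 0) :
    fanEval n true (map L z) = fanEval n true (map L' z) := by
  have hP : extend (prism L L') z ∈ Supp {l | l ∈ Compatible n ∧ n < l.length} := by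
    refine apply_mem (fun l hl => ?_) hz
    rw [extend_single]
    refine supp_mono ?_ (prism_mem L L' l)
    rintro l' ⟨hlen, hl'⟩
    refine ⟨⟨fun x hx => ?_, fun x hx y hy hxy => ?_⟩, ?_⟩
    · obtain ⟨v, -, rfl | rfl⟩ := hl' x hx
      exacts [hlt v, hlt' v]
    · obtain ⟨u, hu, rfl | rfl⟩ := hl' x hx <;> obtain ⟨v, hv, rfl | rfl⟩ := hl' y hy
      · exact h₁ u v (hl.2 u hu v hv) hxy
      · exact h₂ u v (hl.2 u hu v hv) hxy
      · exact (h₂ v u (hl.2 v hv u hu) hxy.symm).symm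
      · exact h₃ u v (hl.2 u hu v hv) hxy
    · rw [hlen, hl.1]
      exact n.lt_succ_self
  have h := fanEval_boundary n true (supp_mono (fun l hl => hl.1) hP)
  have hzero := fun s => fanEval_eq_zero s (supp_mono (fun l hl => hl.2) hP)
  rw [hzero, hzero, boundary_extend_prism, hz0, map_zero, add_zero, add_zero, map_add] at h
  exact CharTwo.add_eq_zero.1 h

end Label

/-- Vectors can be labelled by the index and the sign of a coordinate of maximal absolute value. -/
lemma exists_label {n : ℕ} (hn : 0 < n) : ∃ L : (Fin n → ℝ) → ℕ × Bool,
    (∀ x, (L x).1 < n) ∧ (∀ x, x ≠ 0 → L (-x) = ((L x).1, !(L x).2)) ∧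
    ∀ x y, ‖x - y‖ < ‖x‖ + ‖y‖ → (L x).1 = (L y).1 → L x = L y := by
  have : Nonempty (Fin n) := ⟨⟨0, hn⟩⟩
  choose i hi using fun g : Fin n → ℝ => Finite.exists_max g
  have hnorm : ∀ x : Fin n → ℝ, |x (i |x|)| = ‖x‖ := fun x =>
    le_antisymm (norm_le_pi_norm x _)
      ((pi_norm_le_iff_of_nonneg (abs_nonneg _)).2 fun j => hi |x| j)
  refine ⟨fun x => (i |x|, decide (0 < x (i |x|))), fun x => (i |x|).2, fun x hx => ?_,
    fun x y hxy h => ?_⟩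
  · have h0 : x (i |x|) ≠ 0 := by
      rw [← abs_pos, hnorm]
      exact norm_pos_iff.2 hx
    simp only [abs_neg, Pi.neg_apply, Left.neg_pos_iff, Prod.mk.injEq, true_and]
    rw [← decide_not, decide_eq_decide, not_lt]
    exact ⟨le_of_lt, fun h => lt_of_le_of_ne h h0⟩
  · have hidx : i |x| = i |y| := Fin.ext h
    have hx := hnorm x
    have hy := hnorm y
    have hd : |x (i |y|) - y (i |y|)| ≤ ‖x - y‖ := norm_le_pi_norm (x - y) _
    rw [hidx] at hx
    simp only [hidx, Prod.mk.injEq, true_and, decide_eq_decide]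
    generalize x (i |y|) = a at *
    generalize y (i |y|) = b at *
    constructor <;> intro h <;> by_contra! h' <;> grind

end ListChain

open ListChain in
/-- A fixed-point-free continuous involution of the unit sphere of an
`n`-dimensional real inner product space (`n ≥ 2`) sends some point to its antipode. -/
theorem stmt0 {E : Type*} [NormedAddCommGroup E] [InnerProductSpace ℝ E] {n : ℕ}
    (hn : 2 ≤ n) (hdim : Module.finrank ℝ E = n)
    (f : Metric.sphere (0 : E) 1 → Metric.sphere (0 : E) 1)
    (hf : Continuous f) (hinv : f ∘ f = id) (hfix : ∀ u, f u ≠ u) :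
    ∃ u : Metric.sphere (0 : E) 1, ((f u : E)) = -(u : E) := by
  by_contra! hanti
  have hfd : FiniteDimensional ℝ E := Module.finite_of_finrank_pos (by omega)
  have hnt : Nontrivial E := Module.nontrivial_of_finrank_pos (R := ℝ) (by omega)
  obtain ⟨s₀, hs₀⟩ := (NormedSpace.sphere_nonempty (x := (0 : E)) (r := 1)).2 zero_le_one
  obtain ⟨L, hlt, hneg, hcomp⟩ := exists_label (n := n) (by omega)
  let e : E ≃L[ℝ] (Fin n → ℝ) := (Module.finBasisOfFinrankEq ℝ E hdim).equivFunL
  let G : Set.Icc (-1 : ℝ) 1 × Metric.sphere (0 : E) 1 → Fin n → ℝ :=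
    fun p => e ((p.2 : E) + (p.1 : ℝ) • (f p.2 : E))
  have hG : Continuous G := by fun_prop
  have hG0 : ∀ p, G p ≠ 0 := by
    rintro ⟨⟨s, hs⟩, u⟩ h
    have h0 : (u : E) + s • (f u : E) = 0 := e.map_eq_zero_iff.1 h
    have hs1 : |s| = 1 := by
      have := congrArg norm (eq_neg_of_add_eq_zero_left h0)
      rw [norm_neg, norm_smul] at this
      simpa using this.symm
    rcases eq_or_eq_neg_of_abs_eq hs1 with rfl | rfl
    · rw [one_smul] at h0
      exact hanti u (eq_neg_of_add_eq_zero_right h0)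
    · rw [neg_one_smul, ← sub_eq_add_neg, sub_eq_zero] at h0
      exact hfix u (Subtype.ext h0.symm)
  obtain ⟨ρ, hρ, hρG⟩ : ∃ ρ > 0, ∀ p, ρ ≤ ‖G p‖ := by
    have : Nonempty (Set.Icc (-1 : ℝ) 1 × Metric.sphere (0 : E) 1) :=
      ⟨⟨⟨0, by norm_num⟩, ⟨s₀, hs₀⟩⟩⟩
    obtain ⟨p, hp⟩ := Continuous.exists_forall_le' hG.norm (Classical.arbitrary _) (by simp)
    exact ⟨‖G p‖, norm_pos_iff.2 (hG0 p), hp⟩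
  obtain ⟨δ, hδ, hGδ⟩ := Metric.uniformContinuous_iff.1
    (CompactSpace.uniformContinuous_of_continuous hG) ρ hρ
  have hclose : ∀ p q, dist p q < δ → (L (G p)).1 = (L (G q)).1 → L (G p) = L (G q) := by
    intro p q hpq
    refine hcomp _ _ ?_
    have h1 := hGδ hpq
    rw [dist_eq_norm] at h1
    have h2 := hρG p
    have h3 := norm_nonneg (G q)
    linarith
  obtain ⟨m, rfl⟩ : ∃ m, n = m + 1 := ⟨n - 1, by omega⟩
  obtain ⟨η, hη, hηδ, hadd⟩ := exists_add_map_mem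
    (CompactSpace.uniformContinuous_of_continuous hf) (half_pos hδ)
  obtain ⟨c, hc⟩ := exists_tower hf hinv ⟨s₀, hs₀⟩ (k := m) (by omega) hη
  have hconst : IsLocallyConstant fun s : Set.Icc (-1 : ℝ) 1 =>
      fanEval (m + 1) true (map (fun u => L (G (s, u))) (c + map f c)) := by
    rw [IsLocallyConstant.iff_eventually_eq]
    intro s
    filter_upwards [Metric.ball_mem_nhds s hδ] with t ht
    have hd : ∀ s t : Set.Icc (-1 : ℝ) 1, dist s t < δ → ∀ u v : Metric.sphere (0 : E) 1,
        dist u v ≤ δ / 2 → dist (s, u) (t, v) < δ := fun s t hst u v huv =>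
      max_lt hst (huv.trans_lt (half_lt_self hδ))
    exact fanEval_map_eq (fun _ => hlt _) (fun _ => hlt _)
      (fun u v huv => hclose _ _ (hd t t (by simpa using hδ) u v huv))
      (fun u v huv => hclose _ _ (hd t s ht u v huv))
      (fun u v huv => hclose _ _ (hd s s (by simpa using hδ) u v huv))
      (hadd hc.mem) (hc.boundary_add hinv)
  have hff : ∀ u, f (f u) = u := congrFun hinv
  have : PreconnectedSpace (Set.Icc (-1 : ℝ) 1) := Subtype.preconnectedSpace isPreconnected_Icc
  have heq := hconst.apply_eq_of_preconnectedSpace ⟨-1, by norm_num⟩ ⟨1, by norm_num⟩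
  have hodd : ∀ u, L (G (⟨-1, by norm_num⟩, f u)) =
      ((L (G (⟨-1, by norm_num⟩, u))).1, !(L (G (⟨-1, by norm_num⟩, u))).2) := by
    intro u
    rw [← hneg _ (hG0 _)]
    congr 1
    simp only [G, hff, ← map_neg]
    congr 1
    module
  have heven : ∀ u, L (G (⟨1, by norm_num⟩, f u)) = L (G (⟨1, by norm_num⟩, u)) := by
    intro u
    simp only [G, hff, one_smul, add_comm]
  have h1 := (hc.mono hηδ).fanEval_add hodd (fun _ => hlt _) fun u v huv => hclose _ _
    (max_lt (by simpa using hδ) (huv.trans_lt (half_lt_self hδ)))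
  have hodd' := funext hodd
  have heven' := funext heven
  simp only [map_add, map_map, Function.comp_def, hodd', heven'] at heq
  have hnot := fanEval_map_not (m + 1) true (map (fun u => L (G (⟨-1, by norm_num⟩, u))) c)
  rw [map_map, Function.comp_def, Bool.not_true] at hnot
  rw [hnot, h1, CharTwo.add_self_eq_zero] at heq
  exact one_ne_zero heq
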